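/- arXiv:1907.07307 — 3 statements merged into one kernel-verified Lean document; each statement's English description precedes it below -/
import Mathlib

section
/- Suppose Ξ = ℝ^{d_ξ}_+ and the decision variables are unconstrained. Then the optimal value of the problem: minimize over x₀ ∈ ℝ^{d_x}, X ∈ 𝒳, and (y₀^i, Y^i) ∈ ℝ^{d_y} × 𝒴 for i = 1,…,N of Σ_{i=1}^N w_i sup_{ζ∈U^i} [ fᵀ(x₀ + Xζ) + gᵀζ + hᵀ(y₀^i + Y^iζ) ], subject to A(x₀ + Xζ) + Bζ + C(y₀^i + Y^iζ) ≤ d for all ζ ∈ U^i and all i, equals the optimal value of the deterministic problem: minimize over the same variables together with Λ^i ∈ ℝ^{m×d_ξ}_+ and s^i ∈ ℝ^{d_ξ}_+ of Σ_{i=1}^N w_i [ fᵀ(x₀ + Xξ^i) + gᵀξ^i + hᵀ(y₀^i + Y^iξ^i) + (s^i)ᵀξ^i + ε_N ‖Xᵀf + g + (Y^i)ᵀh + s^i‖_* ], subject to A(x₀ + Xξ^i) + Bξ^i + C(y₀^i + Y^iξ^i) + Λ^i ξ^i + ε_N ‖AX + B + CY^i + Λ^i‖_* ≤ d for all i ∈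 {1,…,N}, where the dual norm of a matrix is applied row-wise. -/
open scoped BigOperators

noncomputable section

/-- The dual norm of a norm `nrm` on `ℝⁿ`: `‖y‖_* = sup { yᵀz : ‖z‖ ≤ 1 }`. -/
def dualNorm {n : ℕ} (nrm : (Fin n → ℝ) → ℝ) (y : Fin n → ℝ) : ℝ :=
  sSup {r | ∃ z : Fin n → ℝ, nrm z ≤ 1 ∧ r = ∑ j, y j * z j}

/-- A seminorm on `ℝⁿ` that vanishes only at the origin dominates a multiple of the sup norm. -/
lemma Seminorm.exists_pos_mul_norm_le {n : ℕ} (p : Seminorm ℝ (Fin n → ℝ))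
    (hp : ∀ x, p x = 0 → x = 0) : ∃ k > 0, ∀ x, k * ‖x‖ ≤ p x := by
  have hcont : Continuous p := continuousOn_univ.mp (p.convexOn.continuousOn isOpen_univ)
  rcases (Metric.sphere (0 : Fin n → ℝ) 1).eq_empty_or_nonempty with hS | hS
  · refine ⟨1, one_pos, fun x => ?_⟩
    have hx : x = 0 := by
      by_contra hx
      have : ‖x‖⁻¹ • x ∈ Metric.sphere (0 : Fin n → ℝ) 1 := by
        simp [norm_smul, inv_mul_cancel₀ (norm_ne_zero_iff.mpr hx)]
      simp [hS] at this
    simp [hx]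
  · obtain ⟨x₀, hx₀, hmin⟩ := (isCompact_sphere (0 : Fin n → ℝ) 1).exists_isMinOn hS
      hcont.continuousOn
    refine ⟨p x₀, (apply_nonneg p x₀).lt_of_ne' fun h0 => ?_, fun x => ?_⟩
    · have h1 : ‖x₀‖ = 1 := by simpa using hx₀
      simp [hp x₀ h0] at h1
    · by_cases hx : x = 0
      · simp [hx]
      have hx' : 0 < ‖x‖ := norm_pos_iff.mpr hx
      have hmem : ‖x‖⁻¹ • x ∈ Metric.sphere (0 : Fin n → ℝ) 1 := by
        simp [norm_smul, inv_mul_cancel₀ hx'.ne']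
      have hle : p x₀ ≤ p (‖x‖⁻¹ • x) := hmin hmem
      rw [map_smul_eq_mul, norm_inv, norm_norm, inv_mul_eq_div, le_div_iff₀ hx'] at hle
      exact hle

/-- The set defining the dual norm is bounded above. -/
lemma bddAbove_dualNorm {n : ℕ} (p : Seminorm ℝ (Fin n → ℝ)) (hp : ∀ x, p x = 0 → x = 0)
    (y : Fin n → ℝ) : BddAbove {r | ∃ z : Fin n → ℝ, p z ≤ 1 ∧ r = ∑ j, y j * z j} := by
  obtain ⟨k, hk, hle⟩ := p.exists_pos_mul_norm_le hp
  refine ⟨∑ j, |y j| * (1 / k), ?_⟩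
  rintro r ⟨z, hz, rfl⟩
  refine Finset.sum_le_sum fun j _ => (le_abs_self _).trans ?_
  rw [abs_mul]
  refine mul_le_mul_of_nonneg_left ?_ (abs_nonneg _)
  rw [le_div_iff₀ hk, mul_comm]
  exact (mul_le_mul_of_nonneg_left (norm_le_pi_norm z j) hk.le).trans ((hle z).trans hz)

/-- Hölder's inequality on the ball of radius `ε`. -/
lemma dotProduct_le_mul_dualNorm {n : ℕ} (p : Seminorm ℝ (Fin n → ℝ))
    (hp : ∀ x, p x = 0 → x = 0) {ε : ℝ} (hε : 0 < ε) (y z : Fin n → ℝ) (hz : p z ≤ ε) :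
    y ⬝ᵥ z ≤ ε * dualNorm p y := by
  have hmem : y ⬝ᵥ (ε⁻¹ • z) ≤ dualNorm p y := by
    refine le_csSup (bddAbove_dualNorm p hp y) ⟨ε⁻¹ • z, ?_, rfl⟩
    rw [map_smul_eq_mul, Real.norm_of_nonneg (inv_pos.mpr hε).le, inv_mul_le_iff₀ hε]
    simpa using hz
  rwa [dotProduct_smul, smul_eq_mul, inv_mul_le_iff₀ hε] at hmem

/-- An upper bound for a linear form on the ball of radius `ε` bounds `ε` times its dual norm. -/
lemma mul_dualNorm_le {n : ℕ} (p : Seminorm ℝ (Fin n → ℝ)) {ε : ℝ} (hε : 0 < ε)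
    (y : Fin n → ℝ) {a : ℝ} (ha : ∀ z, p z ≤ ε → y ⬝ᵥ z ≤ a) : ε * dualNorm p y ≤ a := by
  rw [mul_comm, ← le_div_iff₀ hε]
  refine csSup_le ⟨0, 0, by simp, by simp⟩ ?_
  rintro r ⟨z, hz, rfl⟩
  rw [le_div_iff₀ hε, mul_comm]
  have := ha (ε • z) (by
    rw [map_smul_eq_mul, Real.norm_of_nonneg hε.le]
    exact mul_le_of_le_one_right hε.le hz)
  rwa [dotProduct_smul, smul_eq_mul] at this

/-- Weak duality for the support function of a ball intersected with the nonnegative orthant. -/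
lemma dotProduct_le_dual {n : ℕ} (p : Seminorm ℝ (Fin n → ℝ)) (hp : ∀ x, p x = 0 → x = 0)
    {ε : ℝ} (hε : 0 < ε) (c ξ s ζ : Fin n → ℝ) (hs : ∀ j, 0 ≤ s j) (hζ : ∀ j, 0 ≤ ζ j)
    (hball : p (ζ - ξ) ≤ ε) : c ⬝ᵥ ζ ≤ c ⬝ᵥ ξ + s ⬝ᵥ ξ + ε * dualNorm p (c + s) := by
  have h1 := dotProduct_le_mul_dualNorm p hp hε (c + s) (ζ - ξ) hball
  have h2 : 0 ≤ s ⬝ᵥ ζ := Finset.sum_nonneg fun j _ => mul_nonneg (hs j) (hζ j)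
  rw [dotProduct_sub, add_dotProduct, add_dotProduct] at h1
  linarith

/-- Strong duality, with dual attainment, for the support function of a ball intersected with
the nonnegative orthant. -/
lemma exists_dual_le {n : ℕ} (p : Seminorm ℝ (Fin n → ℝ)) {ε : ℝ} (hε : 0 < ε)
    (c ξ : Fin n → ℝ) (hξ : ∀ j, 0 ≤ ξ j) {t : ℝ}
    (ht : ∀ ζ : Fin n → ℝ, (∀ j, 0 ≤ ζ j) → p (ζ - ξ) ≤ ε → c ⬝ᵥ ζ ≤ t) :
    ∃ s : Fin n → ℝ, (∀ j, 0 ≤ s j) ∧ c ⬝ᵥ ξ + s ⬝ᵥ ξ + ε * dualNorm p (c + s) ≤ t := by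
  have hcont : Continuous p := continuousOn_univ.mp (p.convexOn.continuousOn isOpen_univ)
  let P : Set ((Fin n → ℝ) × ℝ) := {x | p (x.1 - ξ) < ε ∧ t < x.2}
  let Q : Set ((Fin n → ℝ) × ℝ) := {x | (∀ j, 0 ≤ x.1 j) ∧ x.2 ≤ c ⬝ᵥ x.1}
  have hPo : IsOpen P :=
    (isOpen_lt (hcont.comp (continuous_fst.sub continuous_const)) continuous_const).inter
      (isOpen_lt continuous_const continuous_snd)
  have hPc : Convex ℝ P := by
    rw [show P = p.ball ξ ε ×ˢ Set.Ioi t by ext x; simp [P, Seminorm.mem_ball]]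
    exact (p.convex_ball ξ ε).prod (convex_Ioi t)
  have hQc : Convex ℝ Q := by
    rintro ⟨x, r⟩ ⟨hx, hr⟩ ⟨y, r'⟩ ⟨hy, hr'⟩ a b ha hb -
    dsimp only at hx hr hy hr'
    refine ⟨fun j => add_nonneg (mul_nonneg ha (hx j)) (mul_nonneg hb (hy j)), ?_⟩
    change a * r + b * r' ≤ c ⬝ᵥ (a • x + b • y)
    rw [dotProduct_add, dotProduct_smul, dotProduct_smul]
    exact add_le_add (mul_le_mul_of_nonneg_left hr ha) (mul_le_mul_of_nonneg_left hr' hb)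
  have hdisj : Disjoint P Q := by
    rw [Set.disjoint_left]
    rintro ⟨x, r⟩ ⟨h1, h2⟩ ⟨h3, h4⟩
    exact absurd (h2.trans_le h4) (not_lt.mpr (ht x h3 h1.le))
  obtain ⟨F, u, hFP, hFQ⟩ := geometric_hahn_banach_open hPc hPo hQc hdisj
  have hu : u ≤ 0 := by simpa using hFQ 0 (by simp [Q])
  have hF0 : ∀ x ∈ Q, 0 ≤ F x := by
    intro x hx
    by_contra! hneg
    have hmem : ((u - 1) / F x) • x ∈ Q := by
      have ha : 0 ≤ (u - 1) / F x := div_nonneg_of_nonpos (by linarith) hneg.le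
      refine ⟨fun j => mul_nonneg ha (hx.1 j), ?_⟩
      change _ * x.2 ≤ c ⬝ᵥ (_ • x.1)
      rw [dotProduct_smul]
      exact mul_le_mul_of_nonneg_left hx.2 ha
    have := hFQ _ hmem
    rw [map_smul, smul_eq_mul, div_mul_cancel₀ _ hneg.ne] at this
    linarith
  let ψ : Fin n → ℝ := fun j => F (Pi.single j 1, 0)
  let β : ℝ := F (0, 1)
  have hF : ∀ z r, F (z, r) = ψ ⬝ᵥ z + r * β := by
    intro z r
    have hz : (z, r) = ∑ j, z j • ((Pi.single j 1, 0) : (Fin n → ℝ) × ℝ) + r • (0, 1) := by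
      ext j
      · simp [Prod.fst_sum, Finset.sum_apply, Pi.single_apply]
      · simp [Prod.snd_sum]
    rw [hz, map_add, map_sum, map_smul]
    simp only [map_smul, smul_eq_mul, dotProduct, ψ, β, mul_comm]
  have hβ : β < 0 := by
    have h1 := hF0 (ξ, c ⬝ᵥ ξ) ⟨hξ, le_rfl⟩
    have h2 := hFP (ξ, max t (c ⬝ᵥ ξ) + 1) ⟨by simpa using hε,
      (le_max_left _ _).trans_lt (lt_add_one _)⟩
    rw [hF] at h1 h2
    have h3 := le_max_right t (c ⬝ᵥ ξ)
    by_contra! hβ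
    nlinarith
  let φ : Fin n → ℝ := (-β)⁻¹ • ψ
  have hφ : ∀ z, ψ ⬝ᵥ z = -β * (φ ⬝ᵥ z) := by
    intro z
    rw [smul_dotProduct, smul_eq_mul, mul_inv_cancel_left₀ (by linarith)]
  have hφQ : ∀ j, c j ≤ φ j := by
    intro j
    have h1 := hF0 (Pi.single j 1, c j) ⟨fun i => by
      by_cases hij : i = j <;> simp [hij], by simp⟩
    rw [hF, hφ] at h1
    simp only [dotProduct_single, mul_one] at h1
    nlinarith
  have hφP : ∀ z, p (z - ξ) < ε → φ ⬝ᵥ z ≤ t := by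
    intro z hz
    refine le_of_forall_gt_imp_ge_of_dense fun r hr => ?_
    have h1 := (hFP (z, r) ⟨hz, hr⟩).trans_le hu
    rw [hF, hφ] at h1
    nlinarith
  refine ⟨φ - c, fun j => sub_nonneg.mpr (hφQ j), ?_⟩
  rw [add_sub_cancel, sub_dotProduct, add_sub_cancel]
  suffices hsuff : ε * dualNorm p φ ≤ t - φ ⬝ᵥ ξ by linarith
  refine mul_dualNorm_le p hε φ fun z hz => ?_
  have hclosed : IsClosed {a : ℝ | φ ⬝ᵥ ξ + a * (φ ⬝ᵥ z) ≤ t} :=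
    isClosed_le (by fun_prop) continuous_const
  have hsub : Set.Ico (0 : ℝ) 1 ⊆ {a : ℝ | φ ⬝ᵥ ξ + a * (φ ⬝ᵥ z) ≤ t} := by
    rintro a ⟨ha0, ha1⟩
    have h1 := hφP (ξ + a • z) (by
      rw [add_sub_cancel_left, map_smul_eq_mul, Real.norm_of_nonneg ha0]
      nlinarith [apply_nonneg p z])
    rwa [dotProduct_add, dotProduct_smul, smul_eq_mul] at h1
  have h1 := closure_minimal hsub hclosed
  rw [closure_Ico zero_ne_one] at h1
  have h2 : φ ⬝ᵥ ξ + 1 * (φ ⬝ᵥ z) ≤ t := h1 ⟨zero_le_one, le_rfl⟩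
  linarith

/-- Passing to pointwise smaller elements of a subset does not change the infimum. -/
lemma Real.sInf_eq_of_subset_of_forall_exists_le {S T : Set ℝ} (hST : S ⊆ T)
    (hTS : ∀ t ∈ T, ∃ s ∈ S, s ≤ t) : sInf S = sInf T := by
  rcases T.eq_empty_or_nonempty with rfl | ⟨t, ht⟩
  · rw [Set.subset_empty_iff.mp hST]
  obtain ⟨s, hs, -⟩ := hTS t ht
  by_cases hb : BddBelow T
  · refine le_antisymm (le_csInf ⟨t, ht⟩ fun x hx => ?_) (csInf_le_csInf hb ⟨s, hs⟩ hST)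
    obtain ⟨y, hy, hyx⟩ := hTS x hx
    exact (csInf_le (hb.mono hST) hy).trans hyx
  · rw [Real.sInf_of_not_bddBelow hb, Real.sInf_of_not_bddBelow]
    rintro ⟨b, hbS⟩
    refine hb ⟨b, fun x hx => ?_⟩
    obtain ⟨y, hy, hyx⟩ := hTS x hx
    exact (hbS hy).trans hyx

/-- The cost of a linear decision rule as an affine function of the uncertain parameter. -/
lemma ldr_cost_eq {dx dξ dy : ℕ} (f : Fin dx → ℝ) (g : Fin dξ → ℝ) (h : Fin dy → ℝ)
    (x₀ : Fin dx → ℝ) (X : Matrix (Fin dx) (Fin dξ) ℝ) (y₀ : Fin dy → ℝ)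
    (Y : Matrix (Fin dy) (Fin dξ) ℝ) (ζ : Fin dξ → ℝ) :
    (∑ j, f j * (x₀ + X.mulVec ζ) j) + (∑ j, g j * ζ j) + ∑ j, h j * (y₀ + Y.mulVec ζ) j
      = (f ⬝ᵥ x₀ + h ⬝ᵥ y₀)
        + (X.transpose.mulVec f + g + Y.transpose.mulVec h) ⬝ᵥ ζ := by
  change f ⬝ᵥ (x₀ + X.mulVec ζ) + g ⬝ᵥ ζ + h ⬝ᵥ (y₀ + Y.mulVec ζ) = _
  rw [dotProduct_add, dotProduct_add, add_dotProduct, add_dotProduct, Matrix.mulVec_transpose,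
    Matrix.mulVec_transpose, Matrix.dotProduct_mulVec, Matrix.dotProduct_mulVec]
  ring

/-- The constraint of a linear decision rule as an affine function of the uncertain parameter. -/
lemma ldr_constraint_eq {m dx dξ dy : ℕ} (A : Matrix (Fin m) (Fin dx) ℝ)
    (B : Matrix (Fin m) (Fin dξ) ℝ) (C : Matrix (Fin m) (Fin dy) ℝ)
    (x₀ : Fin dx → ℝ) (X : Matrix (Fin dx) (Fin dξ) ℝ) (y₀ : Fin dy → ℝ)
    (Y : Matrix (Fin dy) (Fin dξ) ℝ) (ζ : Fin dξ → ℝ) (k : Fin m) :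
    (A.mulVec (x₀ + X.mulVec ζ) + B.mulVec ζ + C.mulVec (y₀ + Y.mulVec ζ)) k
      = (A.mulVec x₀ + C.mulVec y₀) k + (A * X + B + C * Y) k ⬝ᵥ ζ := by
  change _ = _ + (A * X + B + C * Y).mulVec ζ k
  simp only [Matrix.mulVec_add, Matrix.add_mulVec, Matrix.mulVec_mulVec, Pi.add_apply]
  ring

/-- **Deterministic reformulation of the multi-policy approximation with linear decision
rules (Theorem 6).**  With `Ξ = ℝ^{d_ξ}_+`, unconstrained decisions, uncertainty sets
`U^i = {ζ ≥ 0 : ‖ζ − ξ^i‖ ≤ ε}`, and coefficient-matrix classes `𝒳, 𝒴`, the optimal value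
of the robust problem over linear decision rules equals the optimal value of its
deterministic reformulation obtained by conic duality, in which the dual norm is applied
row-wise. -/
theorem multi_policy_ldr_reformulation
    (m dx dξ dy N : ℕ)
    (f : Fin dx → ℝ) (g : Fin dξ → ℝ) (h : Fin dy → ℝ)
    (A : Matrix (Fin m) (Fin dx) ℝ) (B : Matrix (Fin m) (Fin dξ) ℝ)
    (C : Matrix (Fin m) (Fin dy) ℝ) (d : Fin m → ℝ)
    (ξs : Fin N → Fin dξ → ℝ) (hξs : ∀ i j, 0 ≤ ξs i j)
    (w : Fin N → ℝ) (hw : ∀ i, 0 ≤ w i)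
    (ε : ℝ) (hε : 0 < ε)
    (nrm : (Fin dξ → ℝ) → ℝ)
    (hnrm_tri : ∀ x y, nrm (x + y) ≤ nrm x + nrm y)
    (hnrm_homog : ∀ (a : ℝ) (x : Fin dξ → ℝ), nrm (a • x) = |a| * nrm x)
    (hnrm_def : ∀ x, nrm x = 0 → x = 0)
    (𝒳 : Set (Matrix (Fin dx) (Fin dξ) ℝ)) (𝒴 : Set (Matrix (Fin dy) (Fin dξ) ℝ)) :
    -- the robust problem over linear decision rules …
    sInf {r | ∃ (x₀ : Fin dx → ℝ) (X : Matrix (Fin dx) (Fin dξ) ℝ)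
        (y₀ : Fin N → Fin dy → ℝ) (Y : Fin N → Matrix (Fin dy) (Fin dξ) ℝ),
      X ∈ 𝒳 ∧ (∀ i, Y i ∈ 𝒴) ∧
      (∀ (i : Fin N) (ζ : Fin dξ → ℝ), ((∀ j, 0 ≤ ζ j) ∧ nrm (ζ - ξs i) ≤ ε) →
        ∀ rr : Fin m,
          (A.mulVec (x₀ + X.mulVec ζ) + B.mulVec ζ
            + C.mulVec (y₀ i + (Y i).mulVec ζ)) rr ≤ d rr) ∧
      r = ∑ i, w i *
        sSup {v | ∃ ζ : Fin dξ → ℝ, ((∀ j, 0 ≤ ζ j) ∧ nrm (ζ - ξs i) ≤ ε) ∧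
          v = (∑ j, f j * (x₀ + X.mulVec ζ) j) + (∑ j, g j * ζ j)
            + ∑ j, h j * (y₀ i + (Y i).mulVec ζ) j}}
    -- … equals its deterministic reformulation
    = sInf {r | ∃ (x₀ : Fin dx → ℝ) (X : Matrix (Fin dx) (Fin dξ) ℝ)
        (y₀ : Fin N → Fin dy → ℝ) (Y : Fin N → Matrix (Fin dy) (Fin dξ) ℝ)
        (Λ : Fin N → Matrix (Fin m) (Fin dξ) ℝ) (s : Fin N → Fin dξ → ℝ),
      X ∈ 𝒳 ∧ (∀ i, Y i ∈ 𝒴) ∧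
      (∀ i rr j, 0 ≤ Λ i rr j) ∧ (∀ i j, 0 ≤ s i j) ∧
      (∀ (i : Fin N) (rr : Fin m),
        (A.mulVec (x₀ + X.mulVec (ξs i)) + B.mulVec (ξs i)
            + C.mulVec (y₀ i + (Y i).mulVec (ξs i)) + (Λ i).mulVec (ξs i)) rr
          + ε * dualNorm nrm ((A * X + B + C * Y i + Λ i) rr) ≤ d rr) ∧
      r = ∑ i, w i *
        ((∑ j, f j * (x₀ + X.mulVec (ξs i)) j) + (∑ j, g j * ξs i j)
          + (∑ j, h j * (y₀ i + (Y i).mulVec (ξs i)) j) + (∑ j, s i j * ξs i j)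
          + ε * dualNorm nrm (X.transpose.mulVec f + g + (Y i).transpose.mulVec h + s i))} := by
  obtain ⟨p, rfl⟩ : ∃ p : Seminorm ℝ (Fin dξ → ℝ), (p : (Fin dξ → ℝ) → ℝ) = nrm :=
    ⟨Seminorm.of nrm hnrm_tri hnrm_homog, rfl⟩
  simp only [ldr_cost_eq, ldr_constraint_eq]
  refine Real.sInf_eq_of_subset_of_forall_exists_le ?_ ?_
  · rintro r ⟨x₀, X, y₀, Y, hX, hY, hcon, rfl⟩
    have hrow : ∀ (i : Fin N) (k : Fin m), ∃ l : Fin dξ → ℝ, (∀ j, 0 ≤ l j) ∧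
        (A * X + B + C * Y i) k ⬝ᵥ ξs i + l ⬝ᵥ ξs i
          + ε * dualNorm p ((A * X + B + C * Y i) k + l)
          ≤ d k - (A.mulVec x₀ + C.mulVec (y₀ i)) k := by
      refine fun i k => exists_dual_le p hε _ _ (hξs i) fun ζ hζ hball => ?_
      have := hcon i ζ ⟨hζ, hball⟩ k
      linarith
    choose Λ hΛ hΛd using hrow
    have hobj : ∀ i : Fin N, ∃ s : Fin dξ → ℝ, (∀ j, 0 ≤ s j) ∧
        sSup {v | ∃ ζ : Fin dξ → ℝ, ((∀ j, 0 ≤ ζ j) ∧ p (ζ - ξs i) ≤ ε) ∧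
          v = (f ⬝ᵥ x₀ + h ⬝ᵥ y₀ i)
            + (X.transpose.mulVec f + g + (Y i).transpose.mulVec h) ⬝ᵥ ζ}
        = (f ⬝ᵥ x₀ + h ⬝ᵥ y₀ i)
            + (X.transpose.mulVec f + g + (Y i).transpose.mulVec h) ⬝ᵥ ξs i
          + s ⬝ᵥ ξs i
          + ε * dualNorm p (X.transpose.mulVec f + g + (Y i).transpose.mulVec h + s) := by
      intro i
      set c := X.transpose.mulVec f + g + (Y i).transpose.mulVec h
      set V := {v | ∃ ζ : Fin dξ → ℝ, ((∀ j, 0 ≤ ζ j) ∧ p (ζ - ξs i) ≤ ε) ∧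
          v = (f ⬝ᵥ x₀ + h ⬝ᵥ y₀ i) + c ⬝ᵥ ζ}
      have hub : ∀ s : Fin dξ → ℝ, (∀ j, 0 ≤ s j) → ∀ v ∈ V, v ≤ (f ⬝ᵥ x₀ + h ⬝ᵥ y₀ i)
          + c ⬝ᵥ ξs i + s ⬝ᵥ ξs i + ε * dualNorm p (c + s) := by
        rintro s hs v ⟨ζ, ⟨hζ, hball⟩, rfl⟩
        have := dotProduct_le_dual p hnrm_def hε c (ξs i) s ζ hs hζ hball
        linarith
      have hbdd : BddAbove V := ⟨_, hub 0 fun _ => le_rfl⟩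
      have hne : V.Nonempty := ⟨_, ξs i, ⟨hξs i, by simpa using hε.le⟩, rfl⟩
      obtain ⟨s, hs, hle⟩ := exists_dual_le p hε c (ξs i) (hξs i)
        (t := sSup V - (f ⬝ᵥ x₀ + h ⬝ᵥ y₀ i)) fun ζ hζ hball => by
          have := le_csSup hbdd ⟨ζ, ⟨hζ, hball⟩, rfl⟩
          linarith
      exact ⟨s, hs, le_antisymm (csSup_le hne (hub s hs)) (by linarith)⟩
    choose s hs hsd using hobj
    refine ⟨x₀, X, y₀, Y, fun i => Matrix.of (Λ i), s, hX, hY, hΛ, hs, fun i k => ?_,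
      Finset.sum_congr rfl fun i _ => ?_⟩
    · have := hΛd i k
      change _ + Λ i k ⬝ᵥ ξs i + ε * dualNorm p ((A * X + B + C * Y i) k + Λ i k) ≤ _
      rw [ldr_constraint_eq]
      linarith
    · rw [hsd i]
      rfl
  · rintro r ⟨x₀, X, y₀, Y, Λ, s, hX, hY, hΛ, hs, hcon, rfl⟩
    refine ⟨_, ⟨x₀, X, y₀, Y, hX, hY, ?_, rfl⟩, ?_⟩
    · rintro i ζ ⟨hζ, hball⟩ k
      have h1 : (A * X + B + C * Y i) k ⬝ᵥ ζ ≤ (A * X + B + C * Y i) k ⬝ᵥ ξs i + Λ i k ⬝ᵥ ξs i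
          + ε * dualNorm p ((A * X + B + C * Y i + Λ i) k) :=
        dotProduct_le_dual p hnrm_def hε _ _ _ ζ (hΛ i k) hζ hball
      have h2 := hcon i k
      change _ + Λ i k ⬝ᵥ ξs i + _ ≤ _ at h2
      rw [ldr_constraint_eq] at h2
      linarith
    · refine Finset.sum_le_sum fun i _ => mul_le_mul_of_nonneg_left ?_ (hw i)
      refine csSup_le ⟨_, ξs i, ⟨hξs i, by simpa using hε.le⟩, rfl⟩ ?_
      rintro v ⟨ζ, ⟨hζ, hball⟩, rfl⟩
      have h1 := dotProduct_le_dual p hnrm_def hε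
        (X.transpose.mulVec f + g + (Y i).transpose.mulVec h) (ξs i) (s i) ζ (hs i) hζ hball
      change _ ≤ _ + s i ⬝ᵥ ξs i + _
      linarith

end
end

section
/- Let Z ⊆ ℝ^d, let f: Z → ℝ be measurable, let ζ^1,…,ζ^N ∈ Z, let w^1,…,w^N ≥ 0 with Σ_{i=1}^N w^i = 1, and set Q' = Σ_{i=1}^N w^i δ_{ζ^i}. If θ₂ ≥ 2θ₁ ≥ 0, then for every probability measure Q on Z with d₁(Q', Q) ≤ θ₁: E_{ξ∼Q}[f(ξ)] ≤ Σ_{i=1}^N w^i · sup{ f(ζ) : ζ ∈ Z, ‖ζ − ζ^i‖ ≤ θ₂ } + (4θ₁/θ₂) · sup_{ζ∈Z} |f(ζ)|. -/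
open MeasureTheory
open scoped ENNReal BigOperators

noncomputable section

/-- The type-1 Wasserstein distance (coupling form) with respect to a norm `nrm` on `ℝ^d`:
the infimum over all couplings `π` of `μ` and `ν` of the transport cost
`∫ nrm(ξ − ξ') dπ(ξ, ξ')` (as a lower integral, valued in `ℝ≥0∞`). -/
def wass1Coupling {d : ℕ} (nrm : (Fin d → ℝ) → ℝ) (μ ν : Measure (Fin d → ℝ)) : ℝ≥0∞ :=
  ⨅ (π : Measure ((Fin d → ℝ) × (Fin d → ℝ))) (_ : IsProbabilityMeasure π)
    (_ : π.map Prod.fst = μ) (_ : π.map Prod.snd = ν),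
      ∫⁻ x, ENNReal.ofReal (nrm (x.1 - x.2)) ∂π

theorem Seminorm.continuous_of_pi_fin {d : ℕ} (p : Seminorm ℝ (Fin d → ℝ)) : Continuous p := by
  simpa [continuousOn_univ] using p.convexOn.continuousOn isOpen_univ

theorem ae_exists_eq_of_sum_smul_dirac {α ι : Type*} [MeasurableSpace α]
    [MeasurableSingletonClass α] [Fintype ι] (c : ι → ℝ≥0∞) (a : ι → α) :
    ∀ᵐ x ∂(∑ i, c i • Measure.dirac (a i)), ∃ i, x = a i := by
  have hT : MeasurableSet {x | ∃ i, x = a i} :=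
    (Set.finite_range a).measurableSet.congr (by ext x; simp [eq_comm])
  rw [ae_iff, Measure.finsetSum_apply]
  refine Finset.sum_eq_zero fun i _ ↦ ?_
  rw [Measure.smul_apply, ← Set.compl_ofPred, Measure.dirac_apply' _ hT.compl]
  simp

/-- A minimal separation of finitely many points with respect to a definite function. -/
theorem exists_pos_le_of_ne {α ι : Type*} [Finite ι] (D : α → α → ℝ)
    (hD : ∀ x y, x ≠ y → 0 < D x y) (a : ι → α) :
    ∃ r > 0, ∀ i j, a i ≠ a j → r ≤ D (a i) (a j) := by
  classical
  cases isEmpty_or_nonempty ι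
  · exact ⟨1, one_pos, fun i ↦ isEmptyElim i⟩
  let g : ι × ι → ℝ := fun q ↦ if a q.1 = a q.2 then 1 else D (a q.1) (a q.2)
  obtain ⟨q, hq⟩ := Finite.exists_min g
  refine ⟨g q, ?_, fun i j hij ↦ by simpa [g, hij] using hq (i, j)⟩
  simp only [g]
  split_ifs with h
  exacts [one_pos, hD _ _ h]

/-- A measure at Wasserstein distance zero from one concentrated on finitely many points is
concentrated on the same points. -/
theorem ae_exists_eq_of_wass1Coupling_eq_zero {d N : ℕ} (p : Seminorm ℝ (Fin d → ℝ))
    (hp : ∀ x, p x = 0 → x = 0) (a : Fin N → Fin d → ℝ) {μ ν : Measure (Fin d → ℝ)}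
    [IsProbabilityMeasure ν] (hμ : ∀ᵐ x ∂μ, ∃ i, x = a i) (h : wass1Coupling p μ ν = 0) :
    ∀ᵐ x ∂ν, ∃ i, x = a i := by
  have hpc := p.continuous_of_pi_fin
  let D : (Fin d → ℝ) → ℝ≥0∞ := fun x ↦ ⨅ i, ENNReal.ofReal (p (a i - x))
  have hD : Measurable D := by
    refine Measurable.iInf fun i ↦ ENNReal.measurable_ofReal.comp ?_
    exact (hpc.comp (by fun_prop)).measurable
  have hint : ∫⁻ x, D x ∂ν ≤ wass1Coupling p μ ν := by
    refine le_iInf fun π ↦ le_iInf fun _ ↦ le_iInf fun h₁ ↦ le_iInf fun h₂ ↦ ?_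
    rw [← h₂, lintegral_map hD measurable_snd]
    refine lintegral_mono_ae ?_
    rw [← h₁] at hμ
    filter_upwards [ae_of_ae_map measurable_fst.aemeasurable hμ] with x ⟨i, hi⟩
    exact (iInf_le _ i).trans (by rw [hi])
  have h0 : D =ᵐ[ν] 0 := (lintegral_eq_zero_iff hD).1 (le_antisymm (hint.trans h.le) zero_le)
  filter_upwards [h0] with x hx
  cases isEmpty_or_nonempty (Fin N)
  · exact absurd hx (by simp [D, iInf_of_isEmpty])
  obtain ⟨i, hi⟩ := exists_eq_ciInf_of_finite (f := fun i ↦ ENNReal.ofReal (p (a i - x)))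
  have hz : ENNReal.ofReal (p (a i - x)) = 0 := hi.trans hx
  have := hp _ (le_antisymm (ENNReal.ofReal_eq_zero.1 hz) (apply_nonneg p _))
  exact ⟨i, (sub_eq_zero.1 this).symm⟩

/-- An integral comparison under approximately optimal couplings. -/
theorem integral_le_add_mul_of_wass1Coupling_le {d : ℕ} (p : Seminorm ℝ (Fin d → ℝ))
    {μ ν : Measure (Fin d → ℝ)} {f g : (Fin d → ℝ) → ℝ} (hf : Integrable f ν)
    (hg : Integrable g μ) {K θ : ℝ} (hK : 0 ≤ K) (hθ : 0 ≤ θ)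
    (hd : wass1Coupling p μ ν ≤ ENNReal.ofReal θ) {s t : Set (Fin d → ℝ)}
    (hs : ∀ᵐ x ∂μ, x ∈ s) (ht : ∀ᵐ y ∂ν, y ∈ t)
    (hfg : ∀ x ∈ s, ∀ y ∈ t, f y ≤ g x + K * p (x - y)) :
    ∫ y, f y ∂ν ≤ ∫ x, g x ∂μ + K * θ := by
  refine le_of_forall_pos_le_add fun δ hδ ↦ ?_
  set ε := δ / (K + 1) with hε
  have hεpos : 0 < ε := by positivity
  have hKε : K * ε ≤ δ := by
    rw [hε, mul_div_assoc', div_le_iff₀ (by positivity)]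
    nlinarith
  have hlt : wass1Coupling p μ ν < ENNReal.ofReal (θ + ε) :=
    hd.trans_lt ((ENNReal.ofReal_lt_ofReal_iff (by positivity)).2 (by linarith))
  simp only [wass1Coupling, iInf_lt_iff] at hlt
  obtain ⟨π, hπ, h₁, h₂, hc⟩ := hlt
  have hcont : Continuous fun x : (Fin d → ℝ) × (Fin d → ℝ) ↦ p (x.1 - x.2) :=
    p.continuous_of_pi_fin.comp (by fun_prop)
  have hnn : 0 ≤ᵐ[π] fun x ↦ p (x.1 - x.2) := ae_of_all _ fun x ↦ apply_nonneg p _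
  have hpint : Integrable (fun x ↦ p (x.1 - x.2)) π :=
    ⟨hcont.aestronglyMeasurable,
      (hasFiniteIntegral_iff_ofReal hnn).2 (hc.trans ENNReal.ofReal_lt_top)⟩
  have hple : ∫ x, p (x.1 - x.2) ∂π ≤ θ + ε := by
    rw [integral_eq_lintegral_of_nonneg_ae hnn hcont.aestronglyMeasurable]
    exact ENNReal.toReal_le_of_le_ofReal (by positivity) hc.le
  subst h₁ h₂
  have hf' := hf.comp_measurable measurable_snd
  have hg' : Integrable (fun x : (Fin d → ℝ) × (Fin d → ℝ) ↦ g x.1) π :=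
    hg.comp_measurable measurable_fst
  rw [integral_map measurable_snd.aemeasurable hf.1, integral_map measurable_fst.aemeasurable hg.1]
  calc ∫ x, f x.2 ∂π ≤ ∫ x, (g x.1 + K * p (x.1 - x.2)) ∂π := by
        refine integral_mono_ae hf' (hg'.add (hpint.const_mul K)) ?_
        filter_upwards [ae_of_ae_map measurable_fst.aemeasurable hs,
          ae_of_ae_map measurable_snd.aemeasurable ht] with x hx hy
        exact hfg _ hx _ hy
    _ = ∫ x, g x.1 ∂π + K * ∫ x, p (x.1 - x.2) ∂π := by
        rw [integral_add hg' (hpint.const_mul K), integral_const_mul]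
    _ ≤ ∫ x, g x.1 ∂π + K * θ + δ := by
        nlinarith [mul_le_mul_of_nonneg_left hple hK]

/-- **From Wasserstein distributionally robust bounds to sample robust bounds.**
Let `Z ⊆ ℝ^d`, `f : Z → ℝ` measurable and bounded on `Z`, `ζ^1, …, ζ^N ∈ Z`, weights
`w^i ≥ 0` summing to one, and `Q' = Σᵢ wⁱ δ_{ζ^i}`.  If `θ₂ ≥ 2θ₁ ≥ 0`, then every
probability measure `Q` on `Z` with `d₁(Q', Q) ≤ θ₁` satisfies
`E_{ξ∼Q}[f(ξ)] ≤ Σᵢ wⁱ sup{ f(ζ) : ζ ∈ Z, ‖ζ − ζ^i‖ ≤ θ₂ } + (4θ₁/θ₂) sup_{ζ∈Z} |f(ζ)|`. -/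
theorem dro_to_sample_robust (d N : ℕ)
    (nrm : (Fin d → ℝ) → ℝ)
    (hnrm_tri : ∀ x y, nrm (x + y) ≤ nrm x + nrm y)
    (hnrm_homog : ∀ (a : ℝ) (x : Fin d → ℝ), nrm (a • x) = |a| * nrm x)
    (hnrm_def : ∀ x, nrm x = 0 → x = 0)
    (Z : Set (Fin d → ℝ)) (f : (Fin d → ℝ) → ℝ) (hf : Measurable f)
    (hfbdd : ∃ M, ∀ ζ ∈ Z, |f ζ| ≤ M)
    (ζs : Fin N → (Fin d → ℝ)) (hζs : ∀ i, ζs i ∈ Z)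
    (w : Fin N → ℝ) (hw : ∀ i, 0 ≤ w i) (hw1 : ∑ i, w i = 1)
    (θ₁ θ₂ : ℝ) (hθ₁ : 0 ≤ θ₁) (hθ₂ : 2 * θ₁ ≤ θ₂)
    (Q : Measure (Fin d → ℝ)) [IsProbabilityMeasure Q] (hQZ : Q {x | x ∉ Z} = 0)
    (hQclose :
      wass1Coupling nrm (∑ i, ENNReal.ofReal (w i) • Measure.dirac (ζs i)) Q
        ≤ ENNReal.ofReal θ₁) :
    (∫ x, f x ∂Q)
      ≤ (∑ i, w i * sSup {v | ∃ ζ, ζ ∈ Z ∧ nrm (ζ - ζs i) ≤ θ₂ ∧ v = f ζ})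
          + (4 * θ₁ / θ₂) * sSup {v | ∃ ζ ∈ Z, v = |f ζ|} := by
  obtain ⟨p, rfl⟩ : ∃ p : Seminorm ℝ (Fin d → ℝ), nrm = p :=
    ⟨Seminorm.of nrm hnrm_tri hnrm_homog, rfl⟩
  have hθ₂0 : 0 ≤ θ₂ := by linarith
  set M := sSup {v | ∃ ζ ∈ Z, v = |f ζ|}
  set g : (Fin d → ℝ) → ℝ := fun x ↦ sSup {v | ∃ ζ, ζ ∈ Z ∧ p (ζ - x) ≤ θ₂ ∧ v = f ζ}
  have hfM : ∀ ζ ∈ Z, |f ζ| ≤ M := by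
    obtain ⟨B, hB⟩ := hfbdd
    intro ζ hζ
    refine le_csSup ⟨B, ?_⟩ ⟨ζ, hζ, rfl⟩
    rintro _ ⟨ξ, hξ, rfl⟩
    exact hB ξ hξ
  have hM0 : 0 ≤ M := Real.sSup_nonneg (by rintro _ ⟨ζ, _, rfl⟩; exact abs_nonneg _)
  have hfg : ∀ x, ∀ ζ ∈ Z, p (ζ - x) ≤ θ₂ → f ζ ≤ g x := by
    intro x ζ hζ hx
    refine le_csSup ⟨M, ?_⟩ ⟨ζ, hζ, hx, rfl⟩
    rintro _ ⟨ξ, hξ, _, rfl⟩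
    exact (le_abs_self _).trans (hfM ξ hξ)
  have hQZ' : ∀ᵐ x ∂Q, x ∈ Z := hQZ
  have hfint : Integrable f Q :=
    Integrable.of_bound hf.aestronglyMeasurable M (hQZ'.mono fun x hx ↦ hfM x hx)
  have hdirac (i : Fin N) (_ : i ∈ Finset.univ) :
      Integrable g (ENNReal.ofReal (w i) • Measure.dirac (ζs i)) :=
    (integrable_dirac (by simp)).smul_measure ENNReal.ofReal_ne_top
  have hgint : Integrable g (∑ i, ENNReal.ofReal (w i) • Measure.dirac (ζs i)) :=
    integrable_finsetSum_measure.2 hdirac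
  have hgsum : ∫ x, g x ∂(∑ i, ENNReal.ofReal (w i) • Measure.dirac (ζs i))
      = ∑ i, w i * g (ζs i) := by
    rw [integral_finsetSum_measure hdirac]
    exact Finset.sum_congr rfl fun i _ ↦ by
      simp [integral_smul_measure, integral_dirac, ENNReal.toReal_ofReal (hw i)]
  have hsupp := ae_exists_eq_of_sum_smul_dirac (fun i ↦ ENNReal.ofReal (w i)) ζs
  have key (r : ℝ) (hr : 0 < r) (t : Set (Fin d → ℝ)) (ht : ∀ᵐ y ∂Q, y ∈ t)
      (hrt : ∀ i, ∀ y ∈ t, p (ζs i - y) ≤ θ₂ ∨ r ≤ p (ζs i - y)) :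
      ∫ x, f x ∂Q ≤ ∑ i, w i * g (ζs i) + 2 * M / r * θ₁ := by
    rw [← hgsum]
    refine integral_le_add_mul_of_wass1Coupling_le p hfint hgint (by positivity) hθ₁ hQclose
      (s := {x | ∃ i, x = ζs i}) (t := t ∩ Z) hsupp (ht.and hQZ') ?_
    rintro _ ⟨i, rfl⟩ y ⟨hyt, hyZ⟩
    rcases hrt i y hyt with h | h
    · have h1 := hfg (ζs i) y hyZ (by rwa [map_sub_rev])
      have h2 : 0 ≤ 2 * M / r * p (ζs i - y) := by positivity
      linarith
    · have h1 := hfg (ζs i) (ζs i) (hζs i) (by simpa using hθ₂0)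
      have h2 := abs_le.1 (hfM _ (hζs i))
      have h3 := abs_le.1 (hfM _ hyZ)
      have h4 : 2 * M ≤ 2 * M / r * p (ζs i - y) := by
        rw [div_mul_eq_mul_div, le_div_iff₀ hr]
        gcongr
      linarith
  rcases hθ₂0.eq_or_lt with h0 | hpos
  · obtain rfl : θ₁ = 0 := by linarith
    obtain ⟨r, hr, hsep⟩ := exists_pos_le_of_ne (fun x y ↦ p (x - y))
      (fun x y hxy ↦ (apply_nonneg p _).lt_of_ne'
        fun h ↦ hxy (sub_eq_zero.1 (hnrm_def _ h))) ζs
    have hQsupp := ae_exists_eq_of_wass1Coupling_eq_zero p hnrm_def ζs hsupp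
      (le_antisymm (by simpa using hQclose) zero_le)
    have := key r hr {x | ∃ i, x = ζs i} hQsupp (by
      rintro i _ ⟨j, rfl⟩
      by_cases hij : ζs i = ζs j
      · exact Or.inl (by simpa [hij] using hθ₂0)
      · exact Or.inr (hsep i j hij))
    simpa using this
  · refine (key θ₂ hpos Set.univ (by simp) fun i y _ ↦ le_total _ _).trans ?_
    rw [div_mul_eq_mul_div, div_mul_eq_mul_div]
    refine add_le_add_right (div_le_div_of_nonneg_right ?_ hθ₂0) _
    nlinarith [mul_nonneg hM0 hθ₁]

end
end

section
/- Let n ∈ ℕ, c ∈ ℝⁿ, ξ ∈ ℝⁿ with ξ ≥ 0 componentwise, ε > 0, and let ‖·‖ be a norm on ℝⁿ with dual norm ‖·‖_*. Then sup{ cᵀζ : ζ ∈ ℝⁿ, ζ ≥ 0, ‖ζ − ξ‖ ≤ ε } = inf{ (c + λ)ᵀξ + ε‖c + λ‖_* : λ ∈ ℝⁿ, λ ≥ 0 }. -/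
open scoped BigOperators

noncomputable section

/-- Linear functionals on a finite-dimensional space are bounded with respect to any norm. -/
theorem LinearMap.exists_abs_le_mul_of_norm {E : Type*} [AddCommGroup E] [Module ℝ E]
    [FiniteDimensional ℝ E] (nrm : E → ℝ)
    (hnonneg : ∀ x, 0 ≤ nrm x)
    (htri : ∀ x y, nrm (x + y) ≤ nrm x + nrm y)
    (hhomog : ∀ (a : ℝ) (x : E), nrm (a • x) = |a| * nrm x)
    (hdef : ∀ x, nrm x = 0 → x = 0) (f : E →ₗ[ℝ] ℝ) :
    ∃ C, 0 ≤ C ∧ ∀ x, |f x| ≤ C * nrm x := by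
  let : Norm E := ⟨nrm⟩
  have core : NormedSpace.Core ℝ E :=
    { norm_nonneg := hnonneg
      norm_smul := hhomog
      norm_triangle := htri
      norm_eq_zero_iff := fun x => ⟨hdef x, by
        rintro rfl
        have h := hhomog 0 0
        rw [zero_smul, abs_zero, zero_mul] at h
        exact h⟩ }
  let : NormedAddCommGroup E := NormedAddCommGroup.ofCore core
  let : NormedSpace ℝ E := NormedSpace.ofCore core
  exact ⟨‖f.toContinuousLinearMap‖, norm_nonneg _, fun x => f.toContinuousLinearMap.le_opNorm x⟩

open scoped Pointwise in
/-- Lagrange multipliers for the constraint `0 ≤ ζ`: if a convex set contains a point with positive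
coordinates, then an upper bound for a linear functional on the nonnegative part of the set is an
upper bound on the whole set for some Lagrangian. -/
theorem Convex.exists_nonneg_multiplier {ι : Type*} [Fintype ι] {B : Set (ι → ℝ)}
    (hB : Convex ℝ B) (c : ι → ℝ) (S : ℝ) {ζ₀ : ι → ℝ} (hζ₀ : ζ₀ ∈ B) (hpos : ∀ j, 0 < ζ₀ j)
    (hS : ∀ ζ ∈ B, (∀ j, 0 ≤ ζ j) → c ⬝ᵥ ζ ≤ S) :
    ∃ lam : ι → ℝ, (∀ j, 0 ≤ lam j) ∧ ∀ ζ ∈ B, (c + lam) ⬝ᵥ ζ ≤ S := by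
  classical
  let g : (ι → ℝ) →ₗ[ℝ] (ι → ℝ) × ℝ := LinearMap.prod LinearMap.id (dotProductBilin ℝ ℝ c)
  let N : Set ((ι → ℝ) × ℝ) := (Set.univ.pi fun _ => Set.Iio 0) ×ˢ Set.Iio 0
  have hNconv : Convex ℝ N :=
    (convex_pi fun _ _ => convex_Iio 0).prod (convex_Iio 0)
  have hNopen : IsOpen N :=
    (isOpen_set_pi Set.finite_univ fun _ _ => isOpen_Iio).prod isOpen_Iio
  have hnot : ((0 : ι → ℝ), S) ∉ g '' B + N := by
    rintro ⟨_, ⟨ζ, hζ, rfl⟩, ⟨z, r⟩, ⟨hz, hr⟩, h⟩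
    have h1 : ζ + z = 0 := congrArg Prod.fst h
    have h2 : c ⬝ᵥ ζ + r = S := congrArg Prod.snd h
    have hr' : r < 0 := hr
    have := hS ζ hζ fun j => by
      have hj : ζ j + z j = 0 := congrFun h1 j
      have hzj : z j < 0 := hz j trivial
      linarith
    linarith
  obtain ⟨f, hf⟩ := geometric_hahn_banach_open_point ((hB.linear_image g).add hNconv)
    hNopen.add_left hnot
  have hlt : ∀ ζ ∈ B, ∀ p ∈ N, f (g ζ) + f p < f (0, S) := fun ζ hζ p hp => by
    rw [← map_add]
    exact hf _ (Set.add_mem_add ⟨ζ, hζ, rfl⟩ hp)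
  have hone : ∀ t : ℝ, 0 < t → ∀ d : (ι → ℝ) × ℝ, 0 ≤ d → -(t • (1 : (ι → ℝ) × ℝ)) - d ∈ N := by
    rintro t ht ⟨z, r⟩ ⟨hz, hr⟩
    refine ⟨fun j _ => ?_, ?_⟩
    · have : 0 ≤ z j := hz j
      simp
      linarith
    · have : 0 ≤ r := hr
      simp
      linarith
  have hfnonneg : ∀ d : (ι → ℝ) × ℝ, 0 ≤ d → 0 ≤ f d := by
    intro d hd
    by_contra! hneg
    obtain ⟨k, hk⟩ := exists_nat_gt ((f (0, S) - f (g ζ₀) + f 1) / (-f d))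
    rw [div_lt_iff₀ (by linarith)] at hk
    have := hlt ζ₀ hζ₀ _ (hone 1 one_pos ((k : ℝ) • d) (smul_nonneg k.cast_nonneg hd))
    simp only [map_sub, map_neg, map_smul, smul_eq_mul, one_mul] at this
    linarith
  have hle : ∀ ζ ∈ B, f (g ζ) ≤ f (0, S) := by
    intro ζ hζ
    have h1 : 0 ≤ f 1 := hfnonneg 1 zero_le_one
    refine le_of_forall_pos_le_add fun δ hδ => ?_
    have := hlt ζ hζ _ (hone (δ / (f 1 + 1)) (by positivity) 0 le_rfl)
    simp only [map_sub, map_neg, map_smul, smul_eq_mul, map_zero] at this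
    have h2 : δ / (f 1 + 1) * f 1 ≤ δ := by
      rw [div_mul_eq_mul_div, div_le_iff₀ (by linarith)]
      nlinarith
    linarith
  have hf_apply : ∀ (z : ι → ℝ) (r : ℝ),
      f (z, r) = (fun j => f (Pi.single j 1, 0)) ⬝ᵥ z + f (0, 1) * r := by
    intro z r
    have h1 : f (z, 0) = (fun j => f (Pi.single j 1, 0)) ⬝ᵥ z := by
      have := LinearMap.pi_apply_eq_sum_univ (f.toLinearMap ∘ₗ LinearMap.inl ℝ (ι → ℝ) ℝ) z
      have hs : ∀ j : ι, (fun i => if j = i then (1 : ℝ) else 0) = Pi.single j 1 := fun j => by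
        ext i
        simp [Pi.single_apply, eq_comm]
      simpa [hs, dotProduct, mul_comm] using this
    have h2 : f (0, r) = f (0, 1) * r := by
      have : ((0 : ι → ℝ), r) = r • ((0 : ι → ℝ), (1 : ℝ)) := by simp
      rw [this, map_smul, smul_eq_mul, mul_comm]
    rw [← h1, ← h2, ← map_add]
    simp
  have hs : 0 < f (0, 1) := by
    refine (hfnonneg (0, 1) ⟨le_rfl, zero_le_one⟩).lt_of_ne' fun h0 => ?_
    have := hlt ζ₀ hζ₀ (-ζ₀, -1) ⟨fun j _ => by simpa using hpos j, by simp⟩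
    rw [← map_add, show g ζ₀ + (-ζ₀, -1) = (0, c ⬝ᵥ ζ₀ - 1) from
      Prod.ext (add_neg_cancel ζ₀) rfl, hf_apply 0 (_ - 1), hf_apply 0 S, h0] at this
    simp at this
  refine ⟨fun j => f (Pi.single j 1, 0) / f (0, 1), fun j => ?_, fun ζ hζ => ?_⟩
  · exact div_nonneg (hfnonneg _ ⟨Pi.single_nonneg.2 zero_le_one, le_rfl⟩) hs.le
  · have := hle ζ hζ
    rw [show g ζ = (ζ, c ⬝ᵥ ζ) from rfl, hf_apply ζ, hf_apply 0 S, dotProduct_zero, zero_add] at this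
    have h3 : (fun j => f (Pi.single j 1, 0) / f (0, 1)) =
        (f (0, 1))⁻¹ • fun j => f (Pi.single j 1, 0) := by
      ext j
      simp [div_eq_inv_mul]
    rw [add_dotProduct, h3, smul_dotProduct, smul_eq_mul]
    refine le_of_mul_le_mul_left ?_ hs
    rw [mul_add, mul_inv_cancel_left₀ hs.ne']
    linarith

/-- **Strong conic duality for the robust counterpart.**
For a norm `‖·‖` on `ℝⁿ` with dual norm `‖·‖_*`, `c ∈ ℝⁿ`, `ξ ≥ 0`, and `ε > 0`:
`sup{ cᵀζ : ζ ≥ 0, ‖ζ − ξ‖ ≤ ε } = inf{ (c + λ)ᵀξ + ε‖c + λ‖_* : λ ≥ 0 }`. -/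
theorem conic_duality_robust_counterpart (n : ℕ) (c ξ : Fin n → ℝ)
    (hξ : ∀ j, 0 ≤ ξ j) (ε : ℝ) (hε : 0 < ε)
    (nrm : (Fin n → ℝ) → ℝ)
    (hnrm_tri : ∀ x y, nrm (x + y) ≤ nrm x + nrm y)
    (hnrm_homog : ∀ (a : ℝ) (x : Fin n → ℝ), nrm (a • x) = |a| * nrm x)
    (hnrm_def : ∀ x, nrm x = 0 → x = 0) :
    sSup {v | ∃ ζ : Fin n → ℝ, (∀ j, 0 ≤ ζ j) ∧ nrm (ζ - ξ) ≤ ε ∧ v = ∑ j, c j * ζ j}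
      = sInf {v | ∃ lam : Fin n → ℝ, (∀ j, 0 ≤ lam j) ∧
          v = (∑ j, (c j + lam j) * ξ j) + ε * dualNorm nrm (c + lam)} := by
  have hnrm_zero : nrm 0 = 0 := by simpa using hnrm_homog 0 0
  have hnrm_nonneg : ∀ x, 0 ≤ nrm x := fun x => by
    have h1 := hnrm_tri x ((-1 : ℝ) • x)
    rw [hnrm_homog] at h1
    simp [hnrm_zero] at h1
    exact h1
  have hbdd : ∀ y : Fin n → ℝ,
      BddAbove {r | ∃ z : Fin n → ℝ, nrm z ≤ 1 ∧ r = ∑ j, y j * z j} := by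
    intro y
    obtain ⟨C, hC, h⟩ := LinearMap.exists_abs_le_mul_of_norm nrm hnrm_nonneg hnrm_tri hnrm_homog
      hnrm_def (dotProductBilin ℝ ℝ y)
    refine ⟨C, ?_⟩
    rintro _ ⟨z, hz, rfl⟩
    exact (le_abs_self _).trans ((h z).trans (mul_le_of_le_one_right hC hz))
  have hdual : ∀ y w : Fin n → ℝ, nrm w ≤ ε → y ⬝ᵥ w ≤ ε * dualNorm nrm y := by
    intro y w hw
    have h1 : y ⬝ᵥ (ε⁻¹ • w) ≤ dualNorm nrm y := by
      refine le_csSup (hbdd y) ⟨ε⁻¹ • w, ?_, rfl⟩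
      rw [hnrm_homog, abs_of_pos (inv_pos.2 hε)]
      exact inv_mul_le_one_of_le₀ hw hε.le
    rwa [dotProduct_smul, smul_eq_mul, inv_mul_le_iff₀ hε] at h1
  have hweak : ∀ ζ lam : Fin n → ℝ, (∀ j, 0 ≤ ζ j) → nrm (ζ - ξ) ≤ ε → (∀ j, 0 ≤ lam j) →
      c ⬝ᵥ ζ ≤ (c + lam) ⬝ᵥ ξ + ε * dualNorm nrm (c + lam) := by
    intro ζ lam hζ hball hlam
    have h1 := hdual (c + lam) (ζ - ξ) hball
    have h2 : 0 ≤ lam ⬝ᵥ ζ := dotProduct_nonneg_of_nonneg hlam hζ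
    rw [dotProduct_sub, add_dotProduct c lam ζ] at h1
    linarith
  have hξball : nrm (ξ - ξ) ≤ ε := by simpa [hnrm_zero] using hε.le
  apply le_antisymm
  · refine csSup_le ⟨_, ξ, hξ, hξball, rfl⟩ ?_
    rintro _ ⟨ζ, hζ, hball, rfl⟩
    refine le_csInf ⟨_, 0, fun _ => le_rfl, rfl⟩ ?_
    rintro _ ⟨lam, hlam, rfl⟩
    exact hweak ζ lam hζ hball hlam
  · set S := sSup {v | ∃ ζ : Fin n → ℝ, (∀ j, 0 ≤ ζ j) ∧ nrm (ζ - ξ) ≤ ε ∧ v = ∑ j, c j * ζ j}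
    have hS : ∀ ζ : Fin n → ℝ, nrm (ζ - ξ) ≤ ε → (∀ j, 0 ≤ ζ j) → c ⬝ᵥ ζ ≤ S := by
      intro ζ hball hζ
      refine le_csSup ⟨(c + 0) ⬝ᵥ ξ + ε * dualNorm nrm (c + 0), ?_⟩ ⟨ζ, hζ, hball, rfl⟩
      rintro _ ⟨ζ, hζ, hball, rfl⟩
      exact hweak ζ 0 hζ hball fun _ => le_rfl
    have hconv : Convex ℝ {ζ : Fin n → ℝ | nrm (ζ - ξ) ≤ ε} := by
      intro x (hx : nrm (x - ξ) ≤ ε) y (hy : nrm (y - ξ) ≤ ε) a b ha hb hab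
      have h1 : a • x + b • y - ξ = a • (x - ξ) + b • (y - ξ) := by
        rw [smul_sub, smul_sub, sub_add_sub_comm, ← add_smul, hab, one_smul]
      have h2 := hnrm_tri (a • (x - ξ)) (b • (y - ξ))
      rw [← h1, hnrm_homog, hnrm_homog, abs_of_nonneg ha, abs_of_nonneg hb] at h2
      calc nrm (a • x + b • y - ξ) ≤ a * nrm (x - ξ) + b * nrm (y - ξ) := h2
        _ ≤ a * ε + b * ε := by gcongr
        _ = ε := by rw [← add_mul, hab, one_mul]
    have hone := hnrm_nonneg 1
    have hδ : 0 < ε / (nrm 1 + 1) := by positivity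
    have hslater : nrm (ξ + (ε / (nrm 1 + 1)) • 1 - ξ) ≤ ε := by
      rw [add_sub_cancel_left, hnrm_homog, abs_of_pos hδ, div_mul_eq_mul_div,
        div_le_iff₀ (by linarith)]
      nlinarith
    obtain ⟨lam, hlam, hle⟩ := hconv.exists_nonneg_multiplier c S hslater
      (fun j => by simpa using add_pos_of_nonneg_of_pos (hξ j) hδ) hS
    have hval : (c + lam) ⬝ᵥ ξ + ε * dualNorm nrm (c + lam) ≤ S := by
      rw [← le_sub_iff_add_le', ← le_div_iff₀' hε]
      refine csSup_le ⟨_, 0, by simp [hnrm_zero], rfl⟩ ?_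
      rintro _ ⟨z, hz, rfl⟩
      have h1 := hle (ξ + ε • z) (by
        simpa [hnrm_homog, abs_of_pos hε] using mul_le_of_le_one_right hε.le hz)
      rw [dotProduct_add, dotProduct_smul, smul_eq_mul] at h1
      rw [le_div_iff₀' hε, le_sub_iff_add_le']
      exact h1
    refine le_trans (csInf_le ?_ ⟨lam, hlam, rfl⟩) hval
    refine ⟨c ⬝ᵥ ξ, ?_⟩
    rintro _ ⟨lam, hlam, rfl⟩
    exact hweak ξ lam hξ hξball hlam

end
end
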